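/- For all positive integers d_A and d_B, all unitary matrices G_A, H_A ∈ M_{d_A}(ℂ) and G_B, H_B ∈ M_{d_B}(ℂ) satisfying G_A² = I, H_A³ = I, G_B² = I, H_B³ = I, and all unit vectors ζ₁, ζ₂ ∈ ℂ^{d_A} ⊗ ℂ^{d_B}, it is impossible that all of the following hold simultaneously: ⟨(H_A G_A H_A ⊗ H_B G_B H_B)ζ₁, ζ₁⟩ = ⟨(H_A G_A H_A ⊗ H_B G_B H_B)ζ₁, ζ₂⟩ = 1/√2; ⟨(G_A ⊗ I)ζ₁, ζ₁⟩ = ⟨(I ⊗ G_B)ζ₁, ζ₁⟩ = 1; and ⟨(G_A ⊗ I)ζ₂, ζ₂⟩ = ⟨(I ⊗ G_B)ζ₂, ζ₂⟩ = −1. (This is the finite-dimensional nonexistence part of Lemma 3.2 of the paper: equations (17)–(19) cannot be witnessed by a tensor product of finite-dimensional representations of C*(ℤ₂*ℤ₃).) -/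

import Mathlib

open Matrix Kronecker

/-- Inner product on `ι → ℂ`, linear in the first argument and
conjugate-linear in the second. -/
noncomputable def ip {ι : Type*} [Fintype ι] (x y : ι → ℂ) : ℂ :=
  ∑ i, x i * (starRingEnd ℂ) (y i)

/-- `1/√2` as a complex number. -/
noncomputable def invSqrt2 : ℂ := 1 / (Real.sqrt 2 : ℂ)

/-- If `X` and `Y` lie in the `+1` and `-1` parts of a pair of left and right multiplications, then
adding `Y` to `X` strictly increases the rank unless `Y = 0`. -/
theorem eq_zero_of_rank_add_le {m n : Type*} [Fintype m] [Fintype n] [DecidableEq n]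
    {X Y : Matrix m n ℂ} {G : Matrix m m ℂ} {F : Matrix n n ℂ}
    (hrank : (X + Y).rank ≤ X.rank) (hGX : G * X = X) (hGY : G * Y = -Y)
    (hXF : X * F = X) (hYF : Y * F = -Y) : Y = 0 := by
  have hX : (X + Y) * ((2⁻¹ : ℂ) • (1 + F)) = X := by
    rw [Matrix.mul_smul, Matrix.mul_add, Matrix.mul_one, Matrix.add_mul, hXF, hYF]
    ext i j
    simp only [Matrix.smul_apply, Matrix.add_apply, Matrix.neg_apply, smul_eq_mul]
    ring
  have hle : LinearMap.range X.mulVecLin ≤ LinearMap.range (X + Y).mulVecLin := by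
    rintro _ ⟨v, rfl⟩
    refine ⟨((2⁻¹ : ℂ) • (1 + F)) *ᵥ v, ?_⟩
    simp only [Matrix.mulVecLin_apply, Matrix.mulVec_mulVec, hX]
  have heq := Submodule.eq_of_le_of_finrank_le hle hrank
  refine Matrix.ext_of_mulVec_single fun j => ?_
  rw [Matrix.zero_mulVec]
  set v : n → ℂ := Pi.single j 1
  obtain ⟨w, hw⟩ : (X + Y) *ᵥ v ∈ LinearMap.range X.mulVecLin := heq ▸ ⟨v, rfl⟩
  have hYv : Y *ᵥ v = X *ᵥ (w - v) := by
    rw [Matrix.mulVecLin_apply, Matrix.add_mulVec] at hw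
    rw [Matrix.mulVec_sub, hw, add_sub_cancel_left]
  have hneg : Y *ᵥ v = -(Y *ᵥ v) := by
    rw [← Matrix.neg_mulVec, ← hGY, ← Matrix.mulVec_mulVec, hYv, Matrix.mulVec_mulVec, hGX]
  exact self_eq_neg.mp hneg

section ip

variable {ι : Type*} [Fintype ι]

theorem ip_eq_dotProduct (x y : ι → ℂ) : ip x y = x ⬝ᵥ star y := rfl

theorem ip_conj (x y : ι → ℂ) : star (ip x y) = ip y x := by
  simp [ip, mul_comm]

theorem ip_mulVec_mulVec [DecidableEq ι] {M : Matrix ι ι ℂ} (hM : M ∈ Matrix.unitaryGroup ι ℂ)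
    (x y : ι → ℂ) : ip (M *ᵥ x) (M *ᵥ y) = ip x y := by
  rw [ip_eq_dotProduct, ip_eq_dotProduct, Matrix.star_mulVec, dotProduct_comm,
    ← Matrix.dotProduct_mulVec, Matrix.mulVec_mulVec, ← Matrix.star_eq_conjTranspose,
    Matrix.mem_unitaryGroup_iff'.mp hM, Matrix.one_mulVec, dotProduct_comm]

open scoped ComplexOrder in
/-- The equality case of Bessel's inequality for a single vector. -/
theorem eq_of_ip_eq {x y : ι → ℂ} (hxy : ip x y = ip y y) (hxx : ip x x = ip y y) : x = y := by
  have hyx : ip y x = ip y y := by rw [← ip_conj, hxy, ip_conj]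
  have h : (x - y) ⬝ᵥ star (x - y) = 0 := by
    simp only [ip_eq_dotProduct] at hxy hxx hyx
    rw [star_sub, sub_dotProduct, dotProduct_sub, dotProduct_sub, hxx, hxy, hyx]
    ring
  exact sub_eq_zero.mp (dotProduct_self_star_eq_zero.mp h)

theorem mulVec_eq_smul_of_ip_eq [DecidableEq ι] {M : Matrix ι ι ℂ}
    (hM : M ∈ Matrix.unitaryGroup ι ℂ) {x : ι → ℂ} {c : ℂ} (hx : ip x x = 1)
    (hc : c * star c = 1) (h : ip (M *ᵥ x) x = c) : M *ᵥ x = c • x := by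
  have hy : ip (c • x) (c • x) = 1 := by
    rw [ip_eq_dotProduct] at hx ⊢
    rw [star_smul, smul_dotProduct, dotProduct_smul, hx, smul_eq_mul, smul_eq_mul, mul_one, hc]
  refine eq_of_ip_eq ?_ ?_
  · rw [hy, ip_eq_dotProduct, star_smul, dotProduct_smul, ← ip_eq_dotProduct, h, smul_eq_mul,
      mul_comm, hc]
  · rw [ip_mulVec_mulVec hM, hx, hy]

end ip

theorem invSqrt2_mul_self : invSqrt2 * invSqrt2 = 1 / 2 := by
  have h : ((Real.sqrt 2 : ℝ) : ℂ) * (Real.sqrt 2 : ℝ) = 2 := by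
    rw [← Complex.ofReal_mul, Real.mul_self_sqrt zero_le_two, Complex.ofReal_ofNat]
  rw [invSqrt2, div_mul_div_comm, h, one_mul]

theorem star_invSqrt2 : star invSqrt2 = invSqrt2 := by
  simp [invSqrt2]

/-- The finite-dimensional nonexistence part of Lemma 3.2: equations (17)–(19) cannot be
witnessed by a tensor product of finite-dimensional representations of `C*(ℤ₂∗ℤ₃)`. -/
theorem stmt8 (dA dB : ℕ) (hdA : 0 < dA) (hdB : 0 < dB)
    (G_A H_A : Matrix (Fin dA) (Fin dA) ℂ) (G_B H_B : Matrix (Fin dB) (Fin dB) ℂ)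
    (hGA : G_A ∈ Matrix.unitaryGroup (Fin dA) ℂ) (hGA2 : G_A ^ 2 = 1)
    (hHA : H_A ∈ Matrix.unitaryGroup (Fin dA) ℂ) (hHA3 : H_A ^ 3 = 1)
    (hGB : G_B ∈ Matrix.unitaryGroup (Fin dB) ℂ) (hGB2 : G_B ^ 2 = 1)
    (hHB : H_B ∈ Matrix.unitaryGroup (Fin dB) ℂ) (hHB3 : H_B ^ 3 = 1)
    (ζ₁ ζ₂ : Fin dA × Fin dB → ℂ)
    (hζ₁ : ip ζ₁ ζ₁ = 1) (hζ₂ : ip ζ₂ ζ₂ = 1) :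
    ¬ (ip (((H_A * G_A * H_A) ⊗ₖ (H_B * G_B * H_B)).mulVec ζ₁) ζ₁ = invSqrt2 ∧
       ip (((H_A * G_A * H_A) ⊗ₖ (H_B * G_B * H_B)).mulVec ζ₁) ζ₂ = invSqrt2 ∧
       ip ((G_A ⊗ₖ (1 : Matrix (Fin dB) (Fin dB) ℂ)).mulVec ζ₁) ζ₁ = 1 ∧
       ip (((1 : Matrix (Fin dA) (Fin dA) ℂ) ⊗ₖ G_B).mulVec ζ₁) ζ₁ = 1 ∧
       ip ((G_A ⊗ₖ (1 : Matrix (Fin dB) (Fin dB) ℂ)).mulVec ζ₂) ζ₂ = -1 ∧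
       ip (((1 : Matrix (Fin dA) (Fin dA) ℂ) ⊗ₖ G_B).mulVec ζ₂) ζ₂ = -1) := by
  rintro ⟨h₁₁, h₁₂, hA₁, hB₁, hA₂, hB₂⟩
  have hA := Matrix.kronecker_mem_unitary hGA (one_mem (Matrix.unitaryGroup (Fin dB) ℂ))
  have hB := Matrix.kronecker_mem_unitary (one_mem (Matrix.unitaryGroup (Fin dA) ℂ)) hGB
  have hU := Matrix.kronecker_mem_unitary (mul_mem (mul_mem hHA hGA) hHA)
    (mul_mem (mul_mem hHB hGB) hHB)
  have eA₁ := mulVec_eq_smul_of_ip_eq hA hζ₁ (by simp) hA₁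
  have eB₁ := mulVec_eq_smul_of_ip_eq hB hζ₁ (by simp) hB₁
  have eA₂ := mulVec_eq_smul_of_ip_eq hA hζ₂ (by simp) hA₂
  have eB₂ := mulVec_eq_smul_of_ip_eq hB hζ₂ (by simp) hB₂
  rw [one_smul] at eA₁ eB₁
  rw [neg_one_smul] at eA₂ eB₂
  have h₁₂_orth : ip ζ₁ ζ₂ = 0 := by
    have h := ip_mulVec_mulVec hA ζ₁ ζ₂
    rw [eA₁, eA₂, ip_eq_dotProduct, star_neg, dotProduct_neg, ← ip_eq_dotProduct] at h
    exact self_eq_neg.mp h.symm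
  have h₂₁_orth : ip ζ₂ ζ₁ = 0 := by rw [← ip_conj, h₁₂_orth, star_zero]
  have hsum : ip (invSqrt2 • (ζ₁ + ζ₂)) (invSqrt2 • (ζ₁ + ζ₂)) = 1 := by
    simp only [ip_eq_dotProduct] at hζ₁ hζ₂ h₁₂_orth h₂₁_orth ⊢
    simp only [star_smul, star_add, smul_dotProduct, dotProduct_smul, add_dotProduct,
      dotProduct_add, hζ₁, hζ₂, h₁₂_orth, h₂₁_orth, star_invSqrt2, smul_eq_mul]
    linear_combination 2 * invSqrt2_mul_self
  have hW : ((H_A * G_A * H_A) ⊗ₖ (H_B * G_B * H_B)) *ᵥ ζ₁ = invSqrt2 • (ζ₁ + ζ₂) := by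
    refine eq_of_ip_eq ?_ ?_
    · rw [hsum]
      simp only [ip_eq_dotProduct] at h₁₁ h₁₂ ⊢
      simp only [star_smul, star_add, dotProduct_smul, dotProduct_add, h₁₁, h₁₂, star_invSqrt2,
        smul_eq_mul]
      linear_combination 2 * invSqrt2_mul_self
    · rw [ip_mulVec_mulVec hU, hζ₁, hsum]
  obtain ⟨X, rfl⟩ : ∃ X : Matrix (Fin dB) (Fin dA) ℂ, Matrix.vec X = ζ₁ :=
    ⟨Matrix.of fun j i => ζ₁ (i, j), rfl⟩
  obtain ⟨Y, rfl⟩ : ∃ Y : Matrix (Fin dB) (Fin dA) ℂ, Matrix.vec Y = ζ₂ :=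
    ⟨Matrix.of fun j i => ζ₂ (i, j), rfl⟩
  simp only [Matrix.kronecker_mulVec_vec, ← Matrix.vec_add, ← Matrix.vec_smul, ← Matrix.vec_neg,
    Matrix.vec_inj, Matrix.one_mul, Matrix.transpose_one, Matrix.mul_one] at hW eA₁ eB₁ eA₂ eB₂
  have hs : invSqrt2 ≠ 0 := fun h => by simpa [h] using invSqrt2_mul_self
  have hrank : (X + Y).rank ≤ X.rank := by
    have h : X + Y =
        (invSqrt2⁻¹ • (H_B * G_B * H_B)) * X * (H_A * G_A * H_A)ᵀ := by
      rw [Matrix.smul_mul, Matrix.smul_mul, hW, inv_smul_smul₀ hs]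
    rw [h]
    exact (Matrix.rank_mul_le_left _ _).trans (Matrix.rank_mul_le_right _ _)
  have hY := eq_zero_of_rank_add_le hrank eB₁ eB₂ eA₁ eA₂
  simp [hY, ip] at hζ₂
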